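/- Let L be a Leibniz algebra over a field 𝕜 with left center Z, and let ω ∈ C̃^n(L), η ∈ C̃^m(L), λ ∈ C̃^l(L) be representable cochains. Then the bracket satisfies the graded Jacobi identity: {ω, {η,λ}} = {{ω,η}, λ} + (−1)^{nm} {η, {ω,λ}}. Together with graded antisymmetry, the graded Leibniz rule and closure of C̃(L) under · and {·,·}, this makes (C̃(L), ·, {·,·}) a graded Poisson algebra. -/

import Mathlib

open scoped TensorProduct

universe u v w

/-- A (left) Leibniz algebra over a field `𝕜`. -/
structure LeibnizAlg (𝕜 : Type u) [Field 𝕜] (L : Type v) [AddCommGroup L] [Module 𝕜 L] where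
  br : L →ₗ[𝕜] L →ₗ[𝕜] L
  leibniz : ∀ a b c : L, br a (br b c) = br (br a b) c + br b (br a c)

namespace LeibnizAlg

variable {𝕜 : Type u} [Field 𝕜] {L : Type v} [AddCommGroup L] [Module 𝕜 L]
variable (A : LeibnizAlg 𝕜 L)

/-- The left center `Z = {z | z ∘ e = 0 for all e}`. -/
def leftCenter : Submodule 𝕜 L where
  carrier := {z | ∀ e : L, A.br z e = 0}
  add_mem' := by
    intro a b ha hb
    simp only [Set.mem_setOf_eq] at *
    intro e
    rw [map_add, LinearMap.add_apply, ha e, hb e, add_zero]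
  zero_mem' := by
    simp only [Set.mem_setOf_eq]
    intro e
    rw [map_zero, LinearMap.zero_apply]
  smul_mem' := by
    intro c x hx
    simp only [Set.mem_setOf_eq] at *
    intro e
    rw [map_smul, LinearMap.smul_apply, hx e, smul_zero]

lemma mem_leftCenter_iff {z : L} : z ∈ A.leftCenter ↔ ∀ e : L, A.br z e = 0 := Iff.rfl

/-- The symmetric product `(a,b) = a∘b + b∘a`. -/
def sp (a b : L) : L := A.br a b + A.br b a

lemma sp_mem (a b : L) : A.sp a b ∈ A.leftCenter := by
  rw [mem_leftCenter_iff]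
  intro e
  have h1 := A.leibniz a b e
  have h2 := A.leibniz b a e
  have hx : A.br (A.br a b) e = A.br a (A.br b e) - A.br b (A.br a e) :=
    eq_sub_iff_add_eq.mpr h1.symm
  have hy : A.br (A.br b a) e = A.br b (A.br a e) - A.br a (A.br b e) :=
    eq_sub_iff_add_eq.mpr h2.symm
  rw [sp, map_add, LinearMap.add_apply, hx, hy]
  abel

/-- The symmetric product, seen as valued in the left center. -/
def spZ (a b : L) : A.leftCenter := ⟨A.sp a b, A.sp_mem a b⟩

lemma br_mem (e : L) (f : A.leftCenter) : A.br e (f : L) ∈ A.leftCenter := by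
  rw [mem_leftCenter_iff]
  intro e'
  have h := A.leibniz e (f : L) e'
  have hf : A.br (f : L) e' = 0 := (A.mem_leftCenter_iff.mp f.2) e'
  have hf2 : A.br (f : L) (A.br e e') = 0 := (A.mem_leftCenter_iff.mp f.2) _
  rw [hf] at h
  rw [map_zero] at h
  rw [hf2, add_zero] at h
  exact h.symm

/-- The bracket of `L` on its left center. -/
def brZ (e : L) (f : A.leftCenter) : A.leftCenter := ⟨A.br e (f : L), A.br_mem e f⟩

/-- The symmetric product as a bilinear map into the left center. -/
noncomputable def spL : L →ₗ[𝕜] L →ₗ[𝕜] A.leftCenter :=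
  LinearMap.mk₂ 𝕜 A.spZ
    (fun a a' b => Subtype.ext (by
      simp only [spZ, sp, map_add, LinearMap.add_apply, Submodule.coe_add]
      abel))
    (fun c a b => Subtype.ext (by
      simp only [spZ, sp, map_smul, LinearMap.smul_apply, SetLike.val_smul, smul_add]))
    (fun a b b' => Subtype.ext (by
      simp only [spZ, sp, map_add, LinearMap.add_apply, Submodule.coe_add]
      abel))
    (fun c a b => Subtype.ext (by
      simp only [spZ, sp, map_smul, LinearMap.smul_apply, SetLike.val_smul, smul_add]))

end LeibnizAlg

/-- `(S, ι)` is (a model of) the symmetric algebra of the module `Z`: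
it satisfies the universal property. -/
def IsSymAlg {𝕜 : Type u} [Field 𝕜] {Z : Type v} [AddCommGroup Z] [Module 𝕜 Z]
    (S : Type w) [CommRing S] [Algebra 𝕜 S] (ι : Z →ₗ[𝕜] S) : Prop :=
  ∀ (B : Type (max u v w)) [CommRing B] [Algebra 𝕜 B] (g : Z →ₗ[𝕜] B),
    ∃! h : S →ₐ[𝕜] B, ∀ z : Z, h (ι z) = g z

section Shuffles

/-- All ways of splitting a list into a signed pair of complementary subsequences. -/
def shSplits {α : Type*} : List α → List (ℤ × List α × List α)
  | [] => [(1, [], [])]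
  | a :: l =>
      ((shSplits l).map fun t => (t.1, a :: t.2.1, t.2.2)) ++
      ((shSplits l).map fun t => ((-1) ^ t.2.1.length * t.1, t.2.1, a :: t.2.2))

/-- Signed sum over all `(p, l.length - p)`-shuffles of the list `l`. -/
def shSum {α : Type*} {S : Type*} [AddCommGroup S] (p : ℕ) (l : List α)
    (F : List α → List α → S) : S :=
  (((shSplits l).filter fun t => t.2.1.length == p).map fun t => t.1 • F t.2.1 t.2.2).sum

/-- Unsigned sum over all `(p, l.length - p)`-shuffles of the list `l`. -/
def shSumU {α : Type*} {S : Type*} [AddCommMonoid S] (p : ℕ) (l : List α)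
    (F : List α → List α → S) : S :=
  (((shSplits l).filter fun t => t.2.1.length == p).map fun t => F t.2.1 t.2.2).sum

end Shuffles

section Cochains

variable {𝕜 : Type u} [Field 𝕜] {L : Type v} [AddCommGroup L] [Module 𝕜 L]
variable (A : LeibnizAlg 𝕜 L)
variable (S : Type w) [CommRing S] [Algebra 𝕜 S]
variable (ι : A.leftCenter →ₗ[𝕜] S)

/-- `ω` is an `n`-cochain in the standard complex `C(L) = C(L, Z, S^•(Z))`:
its component `ω k`, defined on tuples `es` of `n - 2k` elements of `L` and `k`
elements of the left center, is multilinear, symmetric in the `Z`-arguments, and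
weakly skew-symmetric in the `L`-arguments. -/
structure IsCochain (n : ℕ) (ω : ℕ → List L → List A.leftCenter → S) : Prop where
  add_e : ∀ (k : ℕ) (p q : List L) (x y : L) (fs : List A.leftCenter),
    2*k + (p.length + 1 + q.length) = n → fs.length = k →
    ω k (p ++ (x + y) :: q) fs = ω k (p ++ x :: q) fs + ω k (p ++ y :: q) fs
  smul_e : ∀ (k : ℕ) (p q : List L) (c : 𝕜) (x : L) (fs : List A.leftCenter),
    2*k + (p.length + 1 + q.length) = n → fs.length = k →
    ω k (p ++ (c • x) :: q) fs = c • ω k (p ++ x :: q) fs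
  add_f : ∀ (k : ℕ) (es : List L) (p q : List A.leftCenter) (x y : A.leftCenter),
    2*k + es.length = n → p.length + 1 + q.length = k →
    ω k es (p ++ (x + y) :: q) = ω k es (p ++ x :: q) + ω k es (p ++ y :: q)
  smul_f : ∀ (k : ℕ) (es : List L) (p q : List A.leftCenter) (c : 𝕜) (x : A.leftCenter),
    2*k + es.length = n → p.length + 1 + q.length = k →
    ω k es (p ++ (c • x) :: q) = c • ω k es (p ++ x :: q)
  symm_f : ∀ (k : ℕ) (es : List L) (p q : List A.leftCenter) (x y : A.leftCenter),
    2*k + es.length = n → p.length + 2 + q.length = k →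
    ω k es (p ++ x :: y :: q) = ω k es (p ++ y :: x :: q)
  skew : ∀ (k : ℕ) (p q : List L) (x y : L) (fs : List A.leftCenter),
    2*k + (p.length + 2 + q.length) = n → fs.length = k →
    ω k (p ++ x :: y :: q) fs + ω k (p ++ y :: x :: q) fs
      = - ω (k+1) (p ++ q) (A.spZ x y :: fs)

/-- The product of an `n`-cochain and an `m`-cochain. -/
def cmul (n m : ℕ) (ω η : ℕ → List L → List A.leftCenter → S) :
    ℕ → List L → List A.leftCenter → S :=
  fun k es fs => ∑ i ∈ Finset.range (k+1),
    if 2*i ≤ n ∧ 2*(k-i) ≤ m then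
      shSum (n - 2*i) es fun es₁ es₂ =>
        shSumU i fs fun fs₁ fs₂ => ω i es₁ fs₁ * η (k-i) es₂ fs₂
    else 0

/-- The operator `d₀` of the standard complex, where `ρ` is the action of `L` on
`S^•(Z)` by derivations. -/
def cd0 (ρ : L → Derivation 𝕜 S S) (ω : ℕ → List L → List A.leftCenter → S) :
    ℕ → List L → List A.leftCenter → S :=
  fun k es fs =>
    (∑ a ∈ Finset.range es.length,
      (-1 : ℤ)^a • ρ (es.getD a 0) (ω k (es.eraseIdx a) fs))
    + ∑ a ∈ Finset.range es.length, ∑ b ∈ Finset.Ico (a+1) es.length,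
        (-1 : ℤ)^(a+1) •
          ω k ((es.eraseIdx a).set (b-1) (A.br (es.getD a 0) (es.getD b 0))) fs

/-- The operator `δ` of the standard complex. -/
def cdel (ω : ℕ → List L → List A.leftCenter → S) :
    ℕ → List L → List A.leftCenter → S :=
  fun k es fs => ∑ j ∈ Finset.range fs.length,
    ω (k-1) (((fs.getD j 0 : A.leftCenter) : L) :: es) (fs.eraseIdx j)

/-- The symmetric product with values pushed into `S = S^•(Z)`. -/
noncomputable def spS : L →ₗ[𝕜] L →ₗ[𝕜] S := (A.spL).compr₂ ι

/-- The `S^•(Z)`-bilinear extension of the symmetric product to `S^•(Z) ⊗ L`. -/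
noncomputable def pairT : (S ⊗[𝕜] L) →ₗ[𝕜] (S ⊗[𝕜] L) →ₗ[𝕜] S :=
  TensorProduct.curry <|
    (TensorProduct.lift (LinearMap.mul 𝕜 S)).comp <|
      (TensorProduct.map (TensorProduct.lift (LinearMap.mul 𝕜 S))
        (TensorProduct.lift (spS A S ι))).comp
        (TensorProduct.tensorTensorTensorComm 𝕜 S L S L).toLinearMap

/-- `ω` is a representable `n`-cochain: each of the maps
`e ↦ ω k (es ++ [e]) fs` lies in the image of `φ = pairT`. -/
def IsRepr (n : ℕ) (ω : ℕ → List L → List A.leftCenter → S) : Prop :=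
  ∀ (k : ℕ) (es : List L) (fs : List A.leftCenter),
    2*k + (es.length + 1) = n → fs.length = k →
    ∃ x : S ⊗[𝕜] L, ∀ e : L, pairT A S ι x ((1 : S) ⊗ₜ[𝕜] e) = ω k (es ++ [e]) fs

/-- `ωt` is a choice of `φ`-preimages `ω̃` for the representable cochain `ω`. -/
def IsPre (n : ℕ) (ω : ℕ → List L → List A.leftCenter → S)
    (ωt : ℕ → List L → List A.leftCenter → S ⊗[𝕜] L) : Prop :=
  ∀ (k : ℕ) (es : List L) (fs : List A.leftCenter),
    2*k + (es.length + 1) = n → fs.length = k →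
    ∀ e : L, pairT A S ι (ωt k es fs) ((1 : S) ⊗ₜ[𝕜] e) = ω k (es ++ [e]) fs

/-- `ωc k es x fs` is the extension `ω̌` of `ω (k+1) es (·::fs)` from `Z` to all of
`S = S^•(Z)` in its first `Z`-slot, by the Leibniz rule. -/
structure IsExt (n : ℕ) (ω : ℕ → List L → List A.leftCenter → S)
    (ωc : ℕ → List L → S → List A.leftCenter → S) : Prop where
  on_gen : ∀ (k : ℕ) (es : List L) (fs : List A.leftCenter) (f : A.leftCenter),
    2*(k+1) + es.length = n → fs.length = k →
    ωc k es (ι f) fs = ω (k+1) es (f :: fs)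
  map_add : ∀ (k : ℕ) (es : List L) (fs : List A.leftCenter) (x y : S),
    2*(k+1) + es.length = n → fs.length = k →
    ωc k es (x + y) fs = ωc k es x fs + ωc k es y fs
  map_smul : ∀ (k : ℕ) (es : List L) (fs : List A.leftCenter) (c : 𝕜) (x : S),
    2*(k+1) + es.length = n → fs.length = k →
    ωc k es (c • x) fs = c • ωc k es x fs
  mul_rule : ∀ (k : ℕ) (es : List L) (fs : List A.leftCenter) (x y : S),
    2*(k+1) + es.length = n → fs.length = k →
    ωc k es (x * y) fs = x * ωc k es y fs + y * ωc k es x fs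

/-- The operation `ω ◇ η` built from the Leibniz-rule extension `ωc` of `ω`. -/
def cdiam (n m : ℕ) (ωc : ℕ → List L → S → List A.leftCenter → S)
    (η : ℕ → List L → List A.leftCenter → S) : ℕ → List L → List A.leftCenter → S :=
  fun k es fs => ∑ i ∈ Finset.range (k+1),
    if 2*(i+1) ≤ n ∧ 2*(k-i) ≤ m then
      shSum (n - 2*i - 2) es fun es₁ es₂ =>
        shSumU (k-i) fs fun fs₁ fs₂ => ωc i es₁ (η (k-i) es₂ fs₁) fs₂
    else 0

/-- The operation `ω • η` built from chosen `φ`-preimages `ωt`, `ηt`. -/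
noncomputable def cbull (n m : ℕ)
    (ωt ηt : ℕ → List L → List A.leftCenter → S ⊗[𝕜] L) :
    ℕ → List L → List A.leftCenter → S :=
  fun k es fs => (-1 : ℤ)^(m-1) • ∑ i ∈ Finset.range (k+1),
    if 2*i + 1 ≤ n ∧ 2*(k-i) + 1 ≤ m then
      shSum (n - 2*i - 1) es fun es₁ es₂ =>
        shSumU i fs fun fs₁ fs₂ => pairT A S ι (ωt i es₁ fs₁) (ηt (k-i) es₂ fs₂)
    else 0

/-- The bracket `{ω, η} = ω•η + ω◇η − (−1)^{nm} η◇ω` of representable cochains. -/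
noncomputable def cpbr (n m : ℕ)
    (ω η : ℕ → List L → List A.leftCenter → S)
    (ωt ηt : ℕ → List L → List A.leftCenter → S ⊗[𝕜] L)
    (ωc ηc : ℕ → List L → S → List A.leftCenter → S) :
    ℕ → List L → List A.leftCenter → S :=
  fun k es fs => cbull A S ι n m ωt ηt k es fs + cdiam A S n m ωc η k es fs
    - (-1 : ℤ)^(n*m) • cdiam A S m n ηc ω k es fs

/-- The canonical 3-cochain `Θ`. -/
def ThetaC : ℕ → List L → List A.leftCenter → S :=
  fun k es fs => match k, es, fs with
    | 0, [e₁, e₂, e₃], [] => ι (A.spZ (A.br e₁ e₂) e₃)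
    | 1, [e], [f] => - ι (A.spZ e (f : L))
    | _, _, _ => 0

/-- The 2-cochain `ζ` with `ζ₀ = (·,·)` and `ζ₁(f) = −2f`. -/
def zetaC : ℕ → List L → List A.leftCenter → S :=
  fun k es fs => match k, es, fs with
    | 0, [e₁, e₂], [] => ι (A.spZ e₁ e₂)
    | 1, [], [f] => (-2 : 𝕜) • ι f
    | _, _, _ => 0

/-- The representable 1-cochain `e^♭ = (e, ·)`. -/
def eflat (e : L) : ℕ → List L → List A.leftCenter → S :=
  fun k es fs => match k, es, fs with
    | 0, [e'], [] => ι (A.spZ e e')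
    | _, _, _ => 0

end Cochains

section ShuffleSums

/-- Sum of `F` over all splittings of a list into two complementary subsequences, each
transposition weighted by `ε`. -/
def splitSum {α V : Type*} [AddCommGroup V] (ε : ℤ) : List α → (List α → List α → V) → V
  | [], F => F [] []
  | a :: l, F => splitSum ε l (fun p q => F (a :: p) q) +
      splitSum ε l (fun p q => ε ^ p.length • F p (a :: q))

variable {α β V V' : Type*} [AddCommGroup V] [AddCommGroup V']

lemma splitSum_congr (ε : ℤ) (l : List α) {F G : List α → List α → V}
    (h : ∀ p q, p.length + q.length = l.length → F p q = G p q) :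
    splitSum ε l F = splitSum ε l G := by
  induction l generalizing F G with
  | nil => exact h [] [] rfl
  | cons a l ih =>
    simp only [splitSum]
    congr 1
    · exact ih fun p q hpq => h _ _ (by simp only [List.length_cons]; omega)
    · exact ih fun p q hpq => by rw [h _ _ (by simp only [List.length_cons]; omega)]

lemma splitSum_add (ε : ℤ) (l : List α) (F G : List α → List α → V) :
    splitSum ε l (fun p q => F p q + G p q) = splitSum ε l F + splitSum ε l G := by
  induction l generalizing F G with
  | nil => rfl
  | cons a l ih =>
    simp only [splitSum, smul_add, ih]
    abel

lemma map_splitSum (f : V →+ V') (ε : ℤ) (l : List α) (F : List α → List α → V) :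
    f (splitSum ε l F) = splitSum ε l (fun p q => f (F p q)) := by
  induction l generalizing F with
  | nil => rfl
  | cons a l ih => simp only [splitSum, map_add, ih, map_zsmul]

lemma splitSum_zero (ε : ℤ) (l : List α) : splitSum ε l (fun _ _ => (0 : V)) = 0 :=
  (map_splitSum (0 : V →+ V) ε l fun _ _ => 0).symm

lemma smul_splitSum (c ε : ℤ) (l : List α) (F : List α → List α → V) :
    c • splitSum ε l F = splitSum ε l (fun p q => c • F p q) :=
  map_splitSum (zsmulAddGroupHom c) ε l F

lemma splitSum_sum {κ : Type*} (s : Finset κ) (ε : ℤ) (l : List α)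
    (F : κ → List α → List α → V) :
    splitSum ε l (fun p q => ∑ i ∈ s, F i p q) = ∑ i ∈ s, splitSum ε l (F i) := by
  classical
  induction s using Finset.induction_on with
  | empty => simp only [Finset.sum_empty, splitSum_zero]
  | insert i s hi ih => simp only [Finset.sum_insert hi, splitSum_add, ih]

lemma splitSum_comm (ε ε' : ℤ) (l : List α) (l' : List β)
    (F : List α → List α → List β → List β → V) :
    splitSum ε l (fun p q => splitSum ε' l' (F p q)) =
      splitSum ε' l' (fun r s => splitSum ε l (fun p q => F p q r s)) := by
  induction l generalizing F with
  | nil => rfl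
  | cons a l ih => simp only [splitSum, ih, smul_splitSum, splitSum_add]

lemma splitSum_assoc (ε : ℤ) (l : List α) (F : List α → List α → List α → V) :
    splitSum ε l (fun p q => splitSum ε p (fun r s => F r s q)) =
      splitSum ε l (fun p q => splitSum ε q (fun r s => F p r s)) := by
  induction l generalizing F with
  | nil => rfl
  | cons a l ih =>
    have h : splitSum ε l (fun p q => splitSum ε p fun r s => ε ^ p.length • F r s (a :: q)) =
        splitSum ε l (fun p q => splitSum ε p fun r s =>
          (ε ^ r.length * ε ^ s.length) • F r s (a :: q)) :=
      splitSum_congr _ _ fun p q _ => splitSum_congr _ _ fun r s h => by rw [← h, pow_add]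
    simp only [splitSum, splitSum_add, smul_add, smul_splitSum, smul_smul, h, ih]
    abel

lemma splitSum_swap {ε : ℤ} (hε : ε * ε = 1) (l : List α) (F : List α → List α → V) :
    splitSum ε l F = splitSum ε l (fun p q => ε ^ (p.length * q.length) • F q p) := by
  induction l generalizing F with
  | nil => simp [splitSum]
  | cons a l ih =>
    simp only [splitSum]
    rw [add_comm, ih (fun p q => F (a :: p) q), ih (fun p q => ε ^ p.length • F p (a :: q))]
    congr 1
    · apply splitSum_congr
      intro p q _
      rw [smul_smul]
      congr 1
      rw [List.length_cons, add_mul, one_mul, pow_add]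
    · apply splitSum_congr
      intro p q _
      rw [smul_smul]
      congr 1
      rw [List.length_cons, mul_add, mul_one, pow_add, mul_comm (ε ^ _) (ε ^ p.length), ← mul_assoc,
        ← mul_pow, hε, one_pow, one_mul]

lemma splitSum_concat (ε : ℤ) (l : List α) (e : α) (F : List α → List α → V) :
    splitSum ε (l ++ [e]) F = splitSum ε l (fun p q => F p (q ++ [e])) +
      splitSum ε l (fun p q => ε ^ q.length • F (p ++ [e]) q) := by
  induction l generalizing F with
  | nil => simp [splitSum, add_comm]
  | cons a l ih =>
    simp only [List.cons_append, splitSum, ih, List.length_append, List.length_cons,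
      List.length_nil, zero_add, smul_smul, pow_succ, mul_comm, mul_left_comm, mul_assoc]
    abel

/-- Signed sum over all splittings of a pair of lists, the entries of the first list being odd
and those of the second list even. -/
def wordSum (u : List α × List β) (F : List α × List β → List α × List β → V) : V :=
  splitSum (-1) u.1 fun p q => splitSum 1 u.2 fun r s => F (p, r) (q, s)

lemma wordSum_congr (u : List α × List β) {F G : List α × List β → List α × List β → V}
    (h : ∀ a b, a.1.length + b.1.length = u.1.length → a.2.length + b.2.length = u.2.length →
      F a b = G a b) :
    wordSum u F = wordSum u G :=
  splitSum_congr _ _ fun _ _ h₁ => splitSum_congr _ _ fun _ _ h₂ => h _ _ h₁ h₂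

lemma wordSum_add (u : List α × List β) (F G : List α × List β → List α × List β → V) :
    wordSum u (fun a b => F a b + G a b) = wordSum u F + wordSum u G := by
  simp only [wordSum, splitSum_add]

lemma map_wordSum (f : V →+ V') (u : List α × List β)
    (F : List α × List β → List α × List β → V) :
    f (wordSum u F) = wordSum u (fun a b => f (F a b)) := by
  simp only [wordSum, map_splitSum]

lemma wordSum_zero (u : List α × List β) : wordSum u (fun _ _ => (0 : V)) = 0 := by
  simp only [wordSum, splitSum_zero]

lemma smul_wordSum (c : ℤ) (u : List α × List β)
    (F : List α × List β → List α × List β → V) :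
    c • wordSum u F = wordSum u (fun a b => c • F a b) := by
  simp only [wordSum, smul_splitSum]

lemma wordSum_assoc (u : List α × List β)
    (F : List α × List β → List α × List β → List α × List β → V) :
    wordSum u (fun a v => wordSum a (fun b c => F b c v)) =
      wordSum u (fun a v => wordSum v (fun b c => F a b c)) := by
  simp only [wordSum]
  have h₁ : ∀ p q : List α, splitSum 1 u.2 (fun r s => splitSum (-1) p fun p' q' =>
      splitSum 1 r fun r' s' => F (p', r') (q', s') (q, s)) =
      splitSum (-1) p fun p' q' => splitSum 1 u.2 fun r s => splitSum 1 r fun r' s' =>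
        F (p', r') (q', s') (q, s) := fun p q => by rw [splitSum_comm]
  have h₂ : ∀ p q : List α, splitSum 1 u.2 (fun r s => splitSum (-1) q fun p' q' =>
      splitSum 1 s fun r' s' => F (p, r) (p', r') (q', s')) =
      splitSum (-1) q fun p' q' => splitSum 1 u.2 fun r s => splitSum 1 s fun r' s' =>
        F (p, r) (p', r') (q', s') := fun p q => by rw [splitSum_comm]
  simp only [h₁, h₂]
  rw [splitSum_assoc (-1) u.1 fun p q t => splitSum 1 u.2 fun r s => splitSum 1 r fun r' s' =>
        F (p, r') (q, s') (t, s)]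
  refine splitSum_congr _ _ fun p q _ => splitSum_congr _ _ fun p' q' _ => ?_
  exact splitSum_assoc 1 u.2 fun r s t => F (p, r) (p', s) (q', t)

lemma wordSum_swap (u : List α × List β) (F : List α × List β → List α × List β → V) :
    wordSum u F =
      wordSum u (fun a b => (-1 : ℤ) ^ (a.1.length * b.1.length) • F b a) := by
  simp only [wordSum]
  rw [splitSum_swap (by norm_num)]
  refine splitSum_congr _ _ fun p q _ => ?_
  rw [splitSum_swap (by norm_num), smul_splitSum]
  simp only [one_pow, one_smul]

lemma wordSum_concat (es : List α) (fs : List β) (e : α)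
    (F : List α × List β → List α × List β → V) :
    wordSum (es ++ [e], fs) F = wordSum (es, fs) (fun a b =>
      F a (b.1 ++ [e], b.2) + (-1 : ℤ) ^ b.1.length • F (a.1 ++ [e], a.2) b) := by
  simp only [wordSum, splitSum_concat, splitSum_add, smul_splitSum]

lemma wordSum_cons (es : List α) (fs : List β) (f : β)
    (F : List α × List β → List α × List β → V) :
    wordSum (es, f :: fs) F = wordSum (es, fs) (fun a b =>
      F (a.1, f :: a.2) b + F a (b.1, f :: b.2)) := by
  simp only [wordSum, splitSum, splitSum_add, one_pow, one_smul]

lemma wordSum_left_comm (u : List α × List β)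
    (F : List α × List β → List α × List β → List α × List β → V) :
    wordSum u (fun b v => wordSum v (fun a c => F a b c)) =
      wordSum u (fun a v => wordSum v (fun b c =>
        (-1 : ℤ) ^ (a.1.length * b.1.length) • F a b c)) := by
  rw [← wordSum_assoc u (fun b a c => F a b c), ← wordSum_assoc]
  exact wordSum_congr _ fun v c _ _ => wordSum_swap v _

lemma wordSum_rotate (u : List α × List β)
    (F : List α × List β → List α × List β → List α × List β → V) :
    wordSum u (fun c v => wordSum v (fun a b => F a b c)) =
      wordSum u (fun a v => wordSum v (fun b c =>
        (-1 : ℤ) ^ ((a.1.length + b.1.length) * c.1.length) • F a b c)) := by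
  rw [wordSum_swap, ← wordSum_assoc]
  refine wordSum_congr _ fun v c _ _ => ?_
  rw [smul_wordSum]
  exact wordSum_congr _ fun a b h _ => by rw [h]

end ShuffleSums

section SymAlg

variable {𝕜 : Type u} [Field 𝕜] {Z : Type v} [AddCommGroup Z] [Module 𝕜 Z]
variable {S : Type w} [CommRing S] [Algebra 𝕜 S] {ι : Z →ₗ[𝕜] S}

lemma IsSymAlg.exists_lift (hS : IsSymAlg S ι) {B : Type w} [CommRing B] [Algebra 𝕜 B]
    (g : Z →ₗ[𝕜] B) : ∃ h : S →ₐ[𝕜] B, ∀ z, h (ι z) = g z := by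
  obtain ⟨h, hh, -⟩ := hS (ULift.{max u v} B)
    ((ULift.algEquiv (R := 𝕜) (A := B)).symm.toLinearMap ∘ₗ g)
  refine ⟨(ULift.algEquiv (R := 𝕜) (A := B)).toAlgHom.comp h, fun z => ?_⟩
  have := congrArg ULift.down (hh z)
  exact this

lemma IsSymAlg.algHom_ext (hS : IsSymAlg S ι) {B : Type w} [CommRing B] [Algebra 𝕜 B]
    {h₁ h₂ : S →ₐ[𝕜] B} (h : ∀ z, h₁ (ι z) = h₂ (ι z)) : h₁ = h₂ := by
  let e : B ≃ₐ[𝕜] ULift.{max u v} B := ULift.algEquiv.symm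
  have := (hS (ULift.{max u v} B) (e.toLinearMap ∘ₗ h₁.toLinearMap ∘ₗ ι)).unique
    (y₁ := e.toAlgHom.comp h₁) (y₂ := e.toAlgHom.comp h₂) (fun z => rfl)
    (fun z => congrArg e (h z).symm)
  ext x
  exact e.injective (DFunLike.congr_fun this x)

lemma IsSymAlg.adjoin_range (hS : IsSymAlg S ι) : Algebra.adjoin 𝕜 (Set.range ι) = ⊤ := by
  obtain ⟨h, hh⟩ := hS.exists_lift (B := Algebra.adjoin 𝕜 (Set.range ι))
    (ι.codRestrict (Subalgebra.toSubmodule (Algebra.adjoin 𝕜 (Set.range ι)))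
      fun z => Algebra.subset_adjoin ⟨z, rfl⟩)
  have key : (Algebra.adjoin 𝕜 (Set.range ι)).val.comp h = AlgHom.id 𝕜 S :=
    hS.algHom_ext fun z => congrArg Subtype.val (hh z)
  refine eq_top_iff.mpr fun x _ => ?_
  rw [← AlgHom.id_apply (R := 𝕜) x, ← key]
  exact (h x).2

lemma IsSymAlg.derivation_ext (hS : IsSymAlg S ι) {M : Type*} [AddCommGroup M] [Module 𝕜 M]
    [Module S M] {d₁ d₂ : Derivation 𝕜 S M} (h : ∀ z, d₁ (ι z) = d₂ (ι z)) : d₁ = d₂ :=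
  Derivation.ext_of_adjoin_eq_top _ hS.adjoin_range (by rintro _ ⟨z, rfl⟩; exact h z)

lemma IsSymAlg.exists_derivation (hS : IsSymAlg S ι) (g : Z →ₗ[𝕜] S) :
    ∃ d : Derivation 𝕜 S S, ∀ z, d (ι z) = g z := by
  obtain ⟨h, hh⟩ := hS.exists_lift (B := TrivSqZeroExt S S)
    ((TrivSqZeroExt.inlAlgHom 𝕜 S S).toLinearMap ∘ₗ ι +
      (TrivSqZeroExt.inrHom S S).restrictScalars 𝕜 ∘ₗ g)
  have key : (TrivSqZeroExt.fstHom 𝕜 S S).comp h = AlgHom.id 𝕜 S :=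
    hS.algHom_ext fun z => by simp [hh]
  have fst_h : ∀ x, (h x).fst = x := fun x => DFunLike.congr_fun key x
  refine ⟨Derivation.mk' ((TrivSqZeroExt.sndHom S S).restrictScalars 𝕜 ∘ₗ h.toLinearMap)
    fun x y => ?_, fun z => by simp [hh]⟩
  simp [fst_h, mul_comm]

end SymAlg

section BracketData

variable {𝕜 : Type u} [Field 𝕜] {L : Type v} [AddCommGroup L] [Module 𝕜 L]

/-- Arguments of a cochain: a list of elements of `L` and a list of elements of the left center. -/
abbrev LeibnizAlg.Word (A : LeibnizAlg 𝕜 L) : Type v := List L × List A.leftCenter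

lemma pairT_tmul (A : LeibnizAlg 𝕜 L) (S : Type w) [CommRing S] [Algebra 𝕜 S]
    (ι : A.leftCenter →ₗ[𝕜] S) (s t : S) (e e' : L) :
    pairT A S ι (s ⊗ₜ[𝕜] e) (t ⊗ₜ[𝕜] e') = s * t * ι (A.spZ e e') := by
  simp [pairT, spS, LeibnizAlg.spL]

lemma LeibnizAlg.spZ_comm (A : LeibnizAlg 𝕜 L) (e e' : L) : A.spZ e e' = A.spZ e' e :=
  Subtype.ext (add_comm _ _)

lemma pairT_comm (A : LeibnizAlg 𝕜 L) (S : Type w) [CommRing S] [Algebra 𝕜 S]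
    (ι : A.leftCenter →ₗ[𝕜] S) (x y : S ⊗[𝕜] L) : pairT A S ι x y = pairT A S ι y x := by
  induction x with
  | zero => simp
  | add x₁ x₂ h₁ h₂ => simp [h₁, h₂]
  | tmul s e =>
    induction y with
    | zero => simp
    | add y₁ y₂ h₁ h₂ => simp only [map_add, h₁, h₂, LinearMap.add_apply]
    | tmul t e' => rw [pairT_tmul, pairT_tmul, A.spZ_comm, mul_comm s t]

lemma pairT_tmul_right (A : LeibnizAlg 𝕜 L) (S : Type w) [CommRing S] [Algebra 𝕜 S]
    (ι : A.leftCenter →ₗ[𝕜] S) (x : S ⊗[𝕜] L) (t : S) (e : L) :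
    pairT A S ι x (t ⊗ₜ[𝕜] e) = t * pairT A S ι x (1 ⊗ₜ[𝕜] e) := by
  induction x with
  | zero => simp
  | add x₁ x₂ h₁ h₂ => simp only [map_add, LinearMap.add_apply, h₁, h₂, mul_add]
  | tmul s e' => rw [pairT_tmul, pairT_tmul]; ring

/-- The data entering the bracket of cochains: the values of a cochain, `φ`-preimages of it and the
derivations of `S` extending it in its first even argument. -/
structure BracketData (A : LeibnizAlg 𝕜 L) (S : Type w) [CommRing S] [Algebra 𝕜 S]
    (ι : A.leftCenter →ₗ[𝕜] S) where
  deg : ℕ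
  val : A.Word → S
  pre : A.Word → S ⊗[𝕜] L
  der : A.Word → Derivation 𝕜 S S
  pairT_pre : ∀ a e, pairT A S ι (pre a) (1 ⊗ₜ[𝕜] e) = val (a.1 ++ [e], a.2)
  der_ι : ∀ a f, der a (ι f) = val (a.1, f :: a.2)
  val_eq_zero : ∀ a, ¬ Even (a.1.length + deg) → val a = 0
  pre_eq_zero : ∀ a, Even (a.1.length + deg) → pre a = 0
  der_eq_zero : ∀ a, ¬ Even (a.1.length + deg) → der a = 0

namespace BracketData

variable {A : LeibnizAlg 𝕜 L} {S : Type w} [CommRing S] [Algebra 𝕜 S]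
variable {ι : A.leftCenter →ₗ[𝕜] S}

/-- Weak skew-symmetry in the last two odd arguments and symmetry in the first two even ones. -/
structure IsWeaklySkew (X : BracketData A S ι) : Prop where
  skew : ∀ (a : A.Word) e e', X.val (a.1 ++ [e, e'], a.2) + X.val (a.1 ++ [e', e], a.2) =
    - X.val (a.1, A.spZ e e' :: a.2)
  symm : ∀ (a : A.Word) f f', X.val (a.1, f :: f' :: a.2) = X.val (a.1, f' :: f :: a.2)

/-- The summand of the bracket of `X` and `Y`. -/
noncomputable def summand (X Y : BracketData A S ι) (a b : A.Word) : S :=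
  -((-1 : ℤ) ^ Y.deg • pairT A S ι (X.pre a) (Y.pre b)) + X.der a (Y.val b) - Y.der b (X.val a)

/-- The bracket of `X` and `Y`. -/
noncomputable def bracket (X Y : BracketData A S ι) (u : A.Word) : S :=
  wordSum u (X.summand Y)

/-- The partial evaluation `e ↦ X.val (a, e)`. -/
noncomputable def evalLast (X : BracketData A S ι) (a : A.Word) : L →ₗ[𝕜] S :=
  pairT A S ι (X.pre a) ∘ₗ TensorProduct.mk 𝕜 S L 1

lemma evalLast_apply (X : BracketData A S ι) (a : A.Word) (e : L) :
    X.evalLast a e = X.val (a.1 ++ [e], a.2) := X.pairT_pre a e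

lemma pairT_pre_tmul (X : BracketData A S ι) (a : A.Word) (s : S) (e : L) :
    pairT A S ι (X.pre a) (s ⊗ₜ[𝕜] e) = s * X.val (a.1 ++ [e], a.2) := by
  rw [pairT_tmul_right, X.pairT_pre]

lemma pairT_pre_eq (X : BracketData A S ι) (a : A.Word) (x : S ⊗[𝕜] L) :
    pairT A S ι (X.pre a) x = (X.evalLast a).liftBaseChange S x := by
  induction x with
  | zero => simp
  | add x₁ x₂ h₁ h₂ => simp only [map_add, h₁, h₂]
  | tmul s e => rw [pairT_pre_tmul, LinearMap.liftBaseChange_tmul, evalLast_apply, smul_eq_mul]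

/-- The linear map `e ↦ X.der (a, e)`. -/
noncomputable def derLast (hS : IsSymAlg S ι) (X : BracketData A S ι) (a : A.Word) :
    L →ₗ[𝕜] Derivation 𝕜 S S where
  toFun e := X.der (a.1 ++ [e], a.2)
  map_add' e e' := hS.derivation_ext fun f => by
    simp only [Derivation.add_apply, X.der_ι]
    simp only [← X.evalLast_apply (a.1, f :: a.2), map_add]
  map_smul' c e := hS.derivation_ext fun f => by
    simp only [Derivation.smul_apply, X.der_ι, RingHom.id_apply]
    simp only [← X.evalLast_apply (a.1, f :: a.2), map_smul]

lemma derLast_apply (hS : IsSymAlg S ι) (X : BracketData A S ι) (a : A.Word) (e : L) :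
    X.derLast hS a e = X.der (a.1 ++ [e], a.2) := rfl

lemma IsWeaklySkew.val_concat {X : BracketData A S ι} (hX : X.IsWeaklySkew) (a : A.Word)
    (e e' : L) : X.val (a.1 ++ [e] ++ [e'], a.2) =
      -(X.der a).toLinearMap (spS A S ι e e') - X.evalLast (a.1 ++ [e'], a.2) e := by
  rw [X.evalLast_apply, spS]
  have h := hX.skew a e e'
  rw [← X.der_ι] at h
  simp only [List.append_assoc, List.cons_append, List.nil_append]
  rw [eq_sub_iff_add_eq]
  exact h

/-- The linear map sending `e` to the pairing with `X.pre (a, e)`. -/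
noncomputable def preLast (X : BracketData A S ι) (hX : X.IsWeaklySkew) (a : A.Word) :
    L →ₗ[𝕜] (S ⊗[𝕜] L →ₗ[𝕜] S) where
  toFun e := pairT A S ι (X.pre (a.1 ++ [e], a.2))
  map_add' e₁ e₂ := TensorProduct.ext' fun s e => by
    simp only [LinearMap.add_apply, pairT_pre_tmul, hX.val_concat a, map_add]
    ring
  map_smul' c e₁ := TensorProduct.ext' fun s e => by
    simp only [LinearMap.smul_apply, pairT_pre_tmul, hX.val_concat a, map_smul, RingHom.id_apply,
      ← smul_neg, ← smul_sub, mul_smul_comm]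

lemma preLast_apply (X : BracketData A S ι) (hX : X.IsWeaklySkew) (a : A.Word) (e : L) :
    X.preLast hX a e = pairT A S ι (X.pre (a.1 ++ [e], a.2)) := rfl

/-- The double contraction `∑ s t X.val (a, e, e')` for `x = ∑ s ⊗ e` and `y = ∑ t ⊗ e'`. -/
noncomputable def contractPre (X : BracketData A S ι) (hX : X.IsWeaklySkew) (a : A.Word)
    (x y : S ⊗[𝕜] L) : S :=
  (X.preLast hX a).liftBaseChange S x y

/-- The contraction `∑ s X.der (a, e)` for `x = ∑ s ⊗ e`. -/
noncomputable def contractDer (hS : IsSymAlg S ι) (X : BracketData A S ι) (a : A.Word)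
    (x : S ⊗[𝕜] L) : Derivation 𝕜 S S :=
  (X.derLast hS a).liftBaseChange S x

/-- The contraction `∑ s X.der a (Y.val (b, e))` for `x = ∑ s ⊗ e`. -/
noncomputable def contractVal (X Y : BracketData A S ι) (a b : A.Word) (x : S ⊗[𝕜] L) : S :=
  ((X.der a).toLinearMap ∘ₗ Y.evalLast b).liftBaseChange S x

/-- Extension of `X` to a symmetric biderivation in its first two even arguments. -/
lemma IsWeaklySkew.exists_biderivation (hS : IsSymAlg S ι) {X : BracketData A S ι}
    (hX : X.IsWeaklySkew) (a : A.Word) : ∃ B : S → Derivation 𝕜 S S,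
      (∀ y f, B y (ι f) = X.der (a.1, f :: a.2) y) ∧ ∀ x y, B x y = B y x := by
  have hadd : ∀ f f', X.der (a.1, (f + f') :: a.2) =
      X.der (a.1, f :: a.2) + X.der (a.1, f' :: a.2) := fun f f' =>
    hS.derivation_ext fun g => by
      simp only [Derivation.add_apply, X.der_ι]
      rw [hX.symm a g (f + f'), hX.symm a g f, hX.symm a g f']
      simp only [← X.der_ι (a.1, g :: a.2), map_add]
  have hsmul : ∀ (c : 𝕜) f, X.der (a.1, (c • f) :: a.2) = c • X.der (a.1, f :: a.2) :=
    fun c f => hS.derivation_ext fun g => by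
      simp only [Derivation.smul_apply, X.der_ι]
      rw [hX.symm a g (c • f), hX.symm a g f]
      simp only [← X.der_ι (a.1, g :: a.2), map_smul, Derivation.map_smul]
  choose B hB using fun y => hS.exists_derivation
    { toFun := fun f => X.der (a.1, f :: a.2) y
      map_add' := fun f f' => by rw [hadd, Derivation.add_apply]
      map_smul' := fun c f => by rw [hsmul, Derivation.smul_apply, RingHom.id_apply] }
  replace hB : ∀ y f, B y (ι f) = X.der (a.1, f :: a.2) y := hB
  let B' : S → Derivation 𝕜 S S := fun x => Derivation.mk'
    { toFun := fun y => B y x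
      map_add' := fun y y' => by
        rw [← Derivation.add_apply]
        exact DFunLike.congr_fun (hS.derivation_ext fun f => by simp [hB]) x
      map_smul' := fun c y => by
        rw [RingHom.id_apply, ← Derivation.smul_apply]
        exact DFunLike.congr_fun (hS.derivation_ext fun f => by simp [hB]) x }
    fun y y' => by
      have : B (y * y') = y • B y' + y' • B y := hS.derivation_ext fun f => by simp [hB]
      exact DFunLike.congr_fun this x
  have hgen : ∀ f, B (ι f) = X.der (a.1, f :: a.2) := fun f => hS.derivation_ext fun g => by
    rw [hB, X.der_ι, X.der_ι, hX.symm a]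
  refine ⟨B, hB, fun x y => ?_⟩
  have : B x = B' x := hS.derivation_ext fun f => by
    rw [hB, ← hgen]
    rfl
  rw [this]
  rfl

/-- A symmetric biderivation extending `X` in its first two even arguments. -/
noncomputable def bider (hS : IsSymAlg S ι) (X : BracketData A S ι) (hX : X.IsWeaklySkew)
    (a : A.Word) : S → Derivation 𝕜 S S :=
  (hX.exists_biderivation hS a).choose

lemma bider_ι (hS : IsSymAlg S ι) (X : BracketData A S ι) (hX : X.IsWeaklySkew) (a : A.Word)
    (y : S) (f : A.leftCenter) : X.bider hS hX a y (ι f) = X.der (a.1, f :: a.2) y :=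
  (hX.exists_biderivation hS a).choose_spec.1 y f

lemma bider_comm (hS : IsSymAlg S ι) (X : BracketData A S ι) (hX : X.IsWeaklySkew) (a : A.Word)
    (x y : S) : X.bider hS hX a x y = X.bider hS hX a y x :=
  (hX.exists_biderivation hS a).choose_spec.2 x y

lemma contractPre_tmul (X : BracketData A S ι) (hX : X.IsWeaklySkew) (a : A.Word) (s : S) (e : L)
    (y : S ⊗[𝕜] L) : X.contractPre hX a (s ⊗ₜ e) y =
      s * pairT A S ι (X.pre (a.1 ++ [e], a.2)) y := by
  rw [contractPre, LinearMap.liftBaseChange_tmul, LinearMap.smul_apply, preLast_apply, smul_eq_mul]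

lemma contractDer_tmul (hS : IsSymAlg S ι) (X : BracketData A S ι) (a : A.Word) (s : S) (e : L)
    (x : S) : X.contractDer hS a (s ⊗ₜ e) x = s * X.der (a.1 ++ [e], a.2) x := by
  rw [contractDer, LinearMap.liftBaseChange_tmul, Derivation.smul_apply, derLast_apply,
    smul_eq_mul]

lemma contractVal_tmul (X Y : BracketData A S ι) (a b : A.Word) (s : S) (e : L) :
    X.contractVal Y a b (s ⊗ₜ e) = s * X.der a (Y.val (b.1 ++ [e], b.2)) := by
  rw [contractVal, LinearMap.liftBaseChange_tmul, LinearMap.comp_apply, evalLast_apply,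
    smul_eq_mul]
  rfl

lemma contractDer_ι (hS : IsSymAlg S ι) (X : BracketData A S ι) (a : A.Word) (x : S ⊗[𝕜] L)
    (f : A.leftCenter) :
    X.contractDer hS a x (ι f) = pairT A S ι (X.pre (a.1, f :: a.2)) x := by
  induction x with
  | zero => simp [contractDer]
  | add x y hx hy =>
    rw [map_add, ← hx, ← hy, ← Derivation.add_apply]
    simp only [contractDer, map_add]
  | tmul s e => rw [contractDer_tmul, pairT_pre_tmul, der_ι]

lemma der_pairT_aux (X : BracketData A S ι) (hX : X.IsWeaklySkew) (a : A.Word)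
    (x y : S ⊗[𝕜] L) : X.der a (pairT A S ι x y) =
      ((X.der a).toLinearMap ∘ₗ pairT A S ι y ∘ₗ TensorProduct.mk 𝕜 S L 1).liftBaseChange S x +
      ((X.der a).toLinearMap ∘ₗ pairT A S ι x ∘ₗ TensorProduct.mk 𝕜 S L 1).liftBaseChange S y +
      X.contractPre hX a x y + X.contractPre hX a y x := by
  have hl : ∀ (p q : S ⊗[𝕜] L), (X.der a).toLinearMap ∘ₗ pairT A S ι (p + q) ∘ₗ
      TensorProduct.mk 𝕜 S L 1 = (X.der a).toLinearMap ∘ₗ pairT A S ι p ∘ₗ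
      TensorProduct.mk 𝕜 S L 1 + (X.der a).toLinearMap ∘ₗ pairT A S ι q ∘ₗ
      TensorProduct.mk 𝕜 S L 1 := fun p q => by ext e; simp
  have hb : ∀ (g g' : L →ₗ[𝕜] S), (g + g').liftBaseChange S =
      g.liftBaseChange S + g'.liftBaseChange S := fun g g' =>
    (LinearMap.liftBaseChangeEquiv S).map_add g g'
  induction x with
  | zero =>
    have h0 : (0 : L →ₗ[𝕜] S).liftBaseChange S = 0 := (LinearMap.liftBaseChangeEquiv S).map_zero
    simp [contractPre, h0]
  | add x₁ x₂ h₁ h₂ =>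
    simp only [hl, hb]
    simp only [map_add, LinearMap.add_apply, h₁, h₂, contractPre]
    ring
  | tmul s e =>
    induction y with
    | zero =>
      have h0 : (0 : L →ₗ[𝕜] S).liftBaseChange S = 0 :=
        (LinearMap.liftBaseChangeEquiv S).map_zero
      simp [contractPre, h0]
    | add x₁ x₂ h₁ h₂ =>
      simp only [hl, hb]
      simp only [map_add, LinearMap.add_apply, h₁, h₂, contractPre]
      ring
    | tmul t e' =>
      rw [contractPre_tmul, contractPre_tmul, pairT_pre_tmul, pairT_pre_tmul]
      simp only [LinearMap.liftBaseChange_tmul, LinearMap.comp_apply, TensorProduct.mk_apply,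
        pairT_tmul, Derivation.coeFn_coe, Derivation.leibniz,
        Derivation.map_one_eq_zero, smul_eq_mul, one_mul, List.append_assoc, List.cons_append, List.nil_append,
        A.spZ_comm e' e]
      have h' := hX.skew a e e'
      rw [← X.der_ι] at h'
      linear_combination -(s * t) * h'

lemma der_pairT (X Y Z : BracketData A S ι) (hX : X.IsWeaklySkew) (a b c : A.Word) :
    X.der a (pairT A S ι (Y.pre b) (Z.pre c)) =
      X.contractVal Z a c (Y.pre b) + X.contractVal Y a b (Z.pre c) +
      X.contractPre hX a (Y.pre b) (Z.pre c) + X.contractPre hX a (Z.pre c) (Y.pre b) :=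
  X.der_pairT_aux hX a _ _

/-- The summand of the bracket of `Y` and `Z` with one odd argument contracted with `x`. -/
noncomputable def summandContract (hS : IsSymAlg S ι) (Y Z : BracketData A S ι)
    (hY : Y.IsWeaklySkew) (hZ : Z.IsWeaklySkew) (x : S ⊗[𝕜] L) (b c : A.Word) : S :=
  -((-1 : ℤ) ^ Z.deg • Z.contractPre hZ c x (Y.pre b)) + Y.contractVal Z b c x
    - Z.contractDer hS c x (Y.val b) + Y.contractPre hY b x (Z.pre c)
    + (-1 : ℤ) ^ Z.deg • Y.contractDer hS b x (Z.val c)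
    - (-1 : ℤ) ^ Z.deg • Z.contractVal Y c b x

/-- The summand of the derivation extending the bracket of `Y` and `Z`. -/
noncomputable def summandDer (hS : IsSymAlg S ι) (Y Z : BracketData A S ι)
    (hY : Y.IsWeaklySkew) (hZ : Z.IsWeaklySkew) (b c : A.Word) : Derivation 𝕜 S S :=
  -((-1 : ℤ) ^ Z.deg • (Y.contractDer hS b (Z.pre c) + Z.contractDer hS c (Y.pre b)))
    + Y.bider hS hY b (Z.val c) + ⁅Y.der b, Z.der c⁆ - Z.bider hS hZ c (Y.val b)

lemma summandContract_tmul (hS : IsSymAlg S ι) (Y Z : BracketData A S ι)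
    (hY : Y.IsWeaklySkew) (hZ : Z.IsWeaklySkew) (s : S) (e : L) (b c : A.Word) :
    summandContract hS Y Z hY hZ (s ⊗ₜ e) b c =
      s * (Y.summand Z b (c.1 ++ [e], c.2) +
        (-1 : ℤ) ^ c.1.length • Y.summand Z (b.1 ++ [e], b.2) c) := by
  simp only [summandContract, summand, contractPre_tmul, contractVal_tmul, contractDer_tmul,
    pairT_comm A S ι (Y.pre b)]
  have hsq : (-1 : ℤ) ^ Z.deg * (-1 : ℤ) ^ Z.deg = 1 := by rw [← mul_pow]; simp
  rcases Nat.even_or_odd (c.1.length + Z.deg) with h | h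
  · have hs : (-1 : ℤ) ^ c.1.length = (-1 : ℤ) ^ Z.deg := by
      have := h.neg_one_pow (α := ℤ)
      rw [pow_add] at this
      linear_combination (-1 : ℤ) ^ Z.deg * this - (-1 : ℤ) ^ c.1.length * hsq
    rw [Z.pre_eq_zero c h, hs]
    simp only [zsmul_eq_mul, map_zero]
    ring
  · have hs : (-1 : ℤ) ^ c.1.length = -(-1 : ℤ) ^ Z.deg := by
      have := h.neg_one_pow (α := ℤ)
      rw [pow_add] at this
      linear_combination (-1 : ℤ) ^ Z.deg * this - (-1 : ℤ) ^ c.1.length * hsq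
    rw [Z.val_eq_zero c (Nat.not_even_iff_odd.mpr h), Z.der_eq_zero c (Nat.not_even_iff_odd.mpr h),
      hs]
    have hsq' : (((-1 : ℤ) ^ Z.deg : ℤ) : S) * (((-1 : ℤ) ^ Z.deg : ℤ) : S) = 1 := by
      exact_mod_cast congrArg (Int.cast (R := S)) hsq
    simp only [zsmul_eq_mul, map_zero, Derivation.zero_apply, Int.cast_neg]
    linear_combination (-s * pairT A S ι (Y.pre (b.1 ++ [e], b.2)) (Z.pre c)) * hsq'

variable {X Y Z β : BracketData A S ι}

lemma liftBaseChange_evalLast_bracket (hS : IsSymAlg S ι) (hY : Y.IsWeaklySkew)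
    (hZ : Z.IsWeaklySkew) (hβ : ∀ u, β.val u = Y.bracket Z u) (v : A.Word) (x : S ⊗[𝕜] L) :
    (β.evalLast v).liftBaseChange S x = wordSum v (summandContract hS Y Z hY hZ x) := by
  induction x with
  | zero =>
    rw [map_zero, ← wordSum_zero v]
    refine wordSum_congr _ fun b c _ _ => ?_
    simp [summandContract, contractPre, contractVal, contractDer]
  | add x y hx hy =>
    rw [map_add, hx, hy, ← wordSum_add]
    refine wordSum_congr _ fun b c _ _ => ?_
    simp only [summandContract, contractPre, contractVal, contractDer, map_add, smul_add,
      LinearMap.add_apply, Derivation.add_apply]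
    abel
  | tmul s e =>
    rw [LinearMap.liftBaseChange_tmul, evalLast_apply, hβ, bracket, wordSum_concat, smul_eq_mul]
    refine (map_wordSum (AddMonoidHom.mulLeft s) v _).trans (wordSum_congr _ fun b c _ _ => ?_)
    rw [summandContract_tmul]
    rfl

lemma der_bracket (hS : IsSymAlg S ι) (hY : Y.IsWeaklySkew)
    (hZ : Z.IsWeaklySkew) (hβ : ∀ u, β.val u = Y.bracket Z u) (v : A.Word) :
    β.der v = wordSum v (summandDer hS Y Z hY hZ) := by
  refine hS.derivation_ext fun f => ?_
  let ev : Derivation 𝕜 S S →+ S :=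
    { toFun := fun d => d (ι f), map_zero' := rfl, map_add' := fun _ _ => rfl }
  refine Eq.trans ?_ (map_wordSum ev v _).symm
  rw [β.der_ι, hβ, bracket, wordSum_cons]
  refine wordSum_congr _ fun b c _ _ => ?_
  change _ = summandDer hS Y Z hY hZ b c (ι f)
  simp only [summandDer, summand, Derivation.sub_apply, Derivation.add_apply,
    Derivation.neg_apply, Derivation.smul_apply, Derivation.commutator_apply, contractDer_ι,
    bider_ι, der_ι, pairT_comm A S ι (Y.pre b), smul_add]
  abel

/-- The summand of the iterated bracket of `X`, `Y` and `Z`. -/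
noncomputable def tripleSummand (hS : IsSymAlg S ι) (X Y Z : BracketData A S ι)
    (hY : Y.IsWeaklySkew) (hZ : Z.IsWeaklySkew) (a b c : A.Word) : S :=
  -((-1 : ℤ) ^ (Y.deg + Z.deg) • summandContract hS Y Z hY hZ (X.pre a) b c)
    + X.der a (Y.summand Z b c) - summandDer hS Y Z hY hZ b c (X.val a)

lemma bracket_bracket (hS : IsSymAlg S ι) (hY : Y.IsWeaklySkew)
    (hZ : Z.IsWeaklySkew) (hβ : ∀ u, β.val u = Y.bracket Z u) (hdeg : β.deg = Y.deg + Z.deg)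
    (u : A.Word) :
    X.bracket β u = wordSum u fun a v => wordSum v fun b c =>
      tripleSummand hS X Y Z hY hZ a b c := by
  refine wordSum_congr _ fun a v _ _ => ?_
  rw [summand, pairT_comm, pairT_pre_eq, liftBaseChange_evalLast_bracket hS hY hZ hβ,
    der_bracket hS hY hZ hβ, hβ, bracket, hdeg]
  let ev : Derivation 𝕜 S S →+ S :=
    { toFun := fun d => d (X.val a), map_zero' := rfl, map_add' := fun _ _ => rfl }
  have h₁ := map_wordSum (X.der a).toLinearMap.toAddMonoidHom v (Y.summand Z)
  have h₂ := map_wordSum ev v (summandDer hS Y Z hY hZ)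
  change X.der a _ = _ at h₁
  change (wordSum v (summandDer hS Y Z hY hZ)) (X.val a) = _ at h₂
  rw [h₁, h₂, sub_eq_add_neg, ← neg_smul, smul_wordSum, ← neg_one_smul ℤ (wordSum v _),
    smul_wordSum, ← wordSum_add, ← wordSum_add]
  refine wordSum_congr _ fun b c _ _ => ?_
  rw [tripleSummand, neg_smul, neg_one_smul, sub_eq_add_neg]
  rfl

lemma bracket_comm (X Y : BracketData A S ι) (u : A.Word) :
    X.bracket Y u = -((-1 : ℤ) ^ (X.deg * Y.deg) • Y.bracket X u) := by
  rw [← neg_smul, bracket, wordSum_swap, bracket, smul_wordSum]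
  refine wordSum_congr _ fun a b _ _ => ?_
  simp only [summand, pairT_comm A S ι (X.pre b)]
  rcases Nat.even_or_odd (a.1.length + Y.deg) with ha | ha <;>
  rcases Nat.even_or_odd (b.1.length + X.deg) with hb | hb
  · have hs : (-1 : ℤ) ^ (a.1.length * b.1.length) = (-1) ^ (X.deg * Y.deg) :=
      neg_one_pow_congr (by
        simp only [Nat.even_add, Nat.even_mul] at *
        tauto)
    rw [hs, Y.pre_eq_zero a ha, map_zero, LinearMap.zero_apply]
    simp only [zsmul_eq_mul]
    push_cast
    ring
  · rw [Nat.not_even_iff_odd.symm] at hb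
    simp [Y.pre_eq_zero a ha, X.val_eq_zero b hb, X.der_eq_zero b hb]
  · rw [Nat.not_even_iff_odd.symm] at ha
    simp [X.pre_eq_zero b hb, Y.val_eq_zero a ha, Y.der_eq_zero a ha]
  · rw [Nat.not_even_iff_odd.symm] at ha hb
    have hs : (-1 : ℤ) ^ (a.1.length * b.1.length + Y.deg + 1) =
        (-1) ^ (X.deg * Y.deg + X.deg) :=
      neg_one_pow_congr (by
        simp only [Nat.even_add, Nat.even_mul, Nat.not_even_one] at *
        tauto)
    simp only [Y.val_eq_zero a ha, Y.der_eq_zero a ha, X.val_eq_zero b hb, X.der_eq_zero b hb,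
      map_zero, add_zero, sub_zero, smul_neg, smul_smul]
    rw [← pow_add, neg_mul, ← pow_add, ← hs, pow_succ]
    simp

lemma contractPre_eq_zero {X : BracketData A S ι} (hX : X.IsWeaklySkew) {a : A.Word}
    (h : ¬ Even (a.1.length + X.deg)) (x y : S ⊗[𝕜] L) : X.contractPre hX a x y = 0 := by
  have : X.preLast hX a = 0 := LinearMap.ext fun e => by
    rw [preLast_apply, X.pre_eq_zero, map_zero, LinearMap.zero_apply]
    simp only [List.length_append, List.length_singleton, Nat.even_add, Nat.not_even_one] at *
    tauto
  induction x with
  | zero => simp [contractPre]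
  | add x₁ x₂ h₁ h₂ =>
    simp only [contractPre, map_add, LinearMap.add_apply] at *
    rw [h₁, h₂, add_zero]
  | tmul s e => rw [contractPre_tmul, ← X.preLast_apply hX, this]; simp

lemma contractDer_eq_zero (hS : IsSymAlg S ι) {X : BracketData A S ι} {a : A.Word}
    (h : Even (a.1.length + X.deg)) (x : S ⊗[𝕜] L) : X.contractDer hS a x = 0 :=
  hS.derivation_ext fun f => by
    rw [contractDer_ι, X.pre_eq_zero (a.1, f :: a.2) h]; simp

lemma contractVal_eq_zero_of_left {X : BracketData A S ι} (Y : BracketData A S ι) {a : A.Word}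
    (h : ¬ Even (a.1.length + X.deg)) (b : A.Word) (x : S ⊗[𝕜] L) :
    X.contractVal Y a b x = 0 := by
  induction x with
  | zero => simp [contractVal]
  | add x₁ x₂ h₁ h₂ =>
    simp only [contractVal, map_add] at *
    rw [h₁, h₂, add_zero]
  | tmul s e => simp [contractVal_tmul, X.der_eq_zero a h]

lemma contractVal_eq_zero_of_right (X : BracketData A S ι) {Y : BracketData A S ι} {b : A.Word}
    (h : Even (b.1.length + Y.deg)) (a : A.Word) (x : S ⊗[𝕜] L) :
    X.contractVal Y a b x = 0 := by
  induction x with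
  | zero => simp [contractVal]
  | add x₁ x₂ h₁ h₂ =>
    simp only [contractVal, map_add] at *
    rw [h₁, h₂, add_zero]
  | tmul s e => simp [contractVal_tmul, ← Y.pairT_pre, Y.pre_eq_zero b h]

lemma bider_eq_zero (hS : IsSymAlg S ι) {X : BracketData A S ι} (hX : X.IsWeaklySkew)
    {a : A.Word} (h : ¬ Even (a.1.length + X.deg)) (x : S) : X.bider hS hX a x = 0 :=
  hS.derivation_ext fun f => by rw [bider_ι, X.der_eq_zero (a.1, f :: a.2) h]; simp

lemma bider_zero (hS : IsSymAlg S ι) (X : BracketData A S ι) (hX : X.IsWeaklySkew)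
    (a : A.Word) : X.bider hS hX a 0 = 0 :=
  hS.derivation_ext fun f => by rw [bider_ι, map_zero, Derivation.zero_apply]

lemma contractPre_zero_left (X : BracketData A S ι) (hX : X.IsWeaklySkew) (a : A.Word)
    (y : S ⊗[𝕜] L) : X.contractPre hX a 0 y = 0 := by
  simp [contractPre]

lemma contractPre_zero_right (X : BracketData A S ι) (hX : X.IsWeaklySkew) (a : A.Word)
    (x : S ⊗[𝕜] L) : X.contractPre hX a x 0 = 0 := map_zero _

lemma contractDer_zero (hS : IsSymAlg S ι) (X : BracketData A S ι) (a : A.Word) :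
    X.contractDer hS a 0 = 0 := map_zero _

lemma contractVal_zero (X Y : BracketData A S ι) (a b : A.Word) :
    X.contractVal Y a b 0 = 0 := map_zero _

section Jacobi

variable {X Y Z : BracketData A S ι}

lemma tripleSummand_jacobi (hS : IsSymAlg S ι) (hX : X.IsWeaklySkew) (hY : Y.IsWeaklySkew)
    (hZ : Z.IsWeaklySkew) (a b c : A.Word) :
    tripleSummand hS X Y Z hY hZ a b c =
      -((-1 : ℤ) ^ ((X.deg + Y.deg) * Z.deg) • ((-1 : ℤ) ^ ((a.1.length + b.1.length) * c.1.length) •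
        tripleSummand hS Z X Y hX hY c a b)) +
      (-1 : ℤ) ^ (X.deg * Y.deg) • ((-1 : ℤ) ^ (a.1.length * b.1.length) •
        tripleSummand hS Y X Z hX hZ b a c) := by
  simp only [tripleSummand, summandContract, summandDer, summand, map_add, map_sub, map_neg,
    map_zsmul, Derivation.sub_apply, Derivation.add_apply, Derivation.neg_apply,
    Derivation.commutator_apply, der_pairT, hX, hY, hZ, Derivation.smul_apply]
  by_cases ha : Even (a.1.length + X.deg) <;> by_cases hb : Even (b.1.length + Y.deg) <;>
  by_cases hc : Even (c.1.length + Z.deg) <;>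
  simp only [ha, hb, hc, pre_eq_zero, val_eq_zero, der_eq_zero, contractPre_eq_zero,
    contractDer_eq_zero, contractVal_eq_zero_of_left, contractVal_eq_zero_of_right, bider_eq_zero,
    bider_zero, contractPre_zero_left, contractPre_zero_right, contractDer_zero, contractVal_zero,
    not_false_eq_true, map_zero, Derivation.zero_apply, add_zero, zero_add, sub_zero, 
    smul_zero, neg_zero]
  all_goals
    try simp only [bider_comm hS X hX a (Z.val c), bider_comm hS Y hY b (Z.val c),
      bider_comm hS Z hZ c (Y.val b)]
    simp only [Nat.even_add] at ha hb hc
    by_cases hn : Even X.deg <;> by_cases hm : Even Y.deg <;> by_cases hl : Even Z.deg <;>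
    simp only [hn, hm, hl, iff_true, iff_false, not_not] at ha hb hc <;>
    simp only [neg_one_pow_eq_ite, Nat.even_add, Nat.even_mul, ha, hb, hc, hn, hm, hl, if_true,
      if_false, iff_true, iff_false, not_true, or_true, or_false,
      or_self, iff_self, one_smul, neg_smul] <;>
    ring

lemma bracket_jacobi {βYZ βXY βXZ : BracketData A S ι} (hS : IsSymAlg S ι) (hX : X.IsWeaklySkew)
    (hY : Y.IsWeaklySkew) (hZ : Z.IsWeaklySkew) (hYZ : ∀ u, βYZ.val u = Y.bracket Z u)
    (hXY : ∀ u, βXY.val u = X.bracket Y u) (hXZ : ∀ u, βXZ.val u = X.bracket Z u)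
    (dYZ : βYZ.deg = Y.deg + Z.deg) (dXY : βXY.deg = X.deg + Y.deg)
    (dXZ : βXZ.deg = X.deg + Z.deg) (u : A.Word) :
    X.bracket βYZ u =
      βXY.bracket Z u + (-1 : ℤ) ^ (X.deg * Y.deg) • Y.bracket βXZ u := by
  rw [bracket_comm βXY Z, bracket_bracket hS hY hZ hYZ dYZ, bracket_bracket hS hX hY hXY dXY,
    bracket_bracket hS hX hZ hXZ dXZ, dXY,
    wordSum_rotate u fun a b c => tripleSummand hS Z X Y hX hY c a b,
    wordSum_left_comm u fun a b c => tripleSummand hS Y X Z hX hZ b a c, ← neg_smul,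
    smul_wordSum, smul_wordSum, ← wordSum_add]
  refine wordSum_congr _ fun a v _ _ => ?_
  rw [smul_wordSum, smul_wordSum, ← wordSum_add]
  refine wordSum_congr _ fun b c _ _ => ?_
  rw [tripleSummand_jacobi hS hX hY hZ, neg_smul]

end Jacobi

end BracketData

end BracketData

section Shuffles

variable {α V : Type*} [AddCommGroup V]

lemma sum_map_shSplits (l : List α) (F : List α → List α → V) :
    ((shSplits l).map fun t => t.1 • F t.2.1 t.2.2).sum = splitSum (-1) l F := by
  induction l generalizing F with
  | nil => simp [shSplits, splitSum]
  | cons a l ih =>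
    simp only [shSplits, splitSum, List.map_append, List.map_map, List.sum_append, ← ih, smul_smul,
      Function.comp_def, mul_comm]

lemma sum_map_shSplits_unsigned (l : List α) (F : List α → List α → V) :
    ((shSplits l).map fun t => F t.2.1 t.2.2).sum = splitSum 1 l F := by
  induction l generalizing F with
  | nil => simp [shSplits, splitSum]
  | cons a l ih =>
    simp only [shSplits, splitSum, List.map_append, List.map_map, List.sum_append, ← ih, one_pow,
      one_smul, Function.comp_def]

lemma List.sum_map_filter_eq {γ : Type*} (l : List γ) (P : γ → Bool) (f : γ → V) :
    ((l.filter P).map f).sum = (l.map fun t => if P t then f t else 0).sum := by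
  induction l with
  | nil => rfl
  | cons a l ih => by_cases h : P a <;> simp [h, ih]

lemma shSum_eq (p : ℕ) (l : List α) (F : List α → List α → V) :
    shSum p l F = splitSum (-1) l fun a b => if a.length = p then F a b else 0 := by
  rw [shSum, List.sum_map_filter_eq, ← sum_map_shSplits]
  simp only [beq_iff_eq, smul_ite, smul_zero]

lemma shSumU_eq (p : ℕ) (l : List α) (F : List α → List α → V) :
    shSumU p l F = splitSum 1 l fun a b => if a.length = p then F a b else 0 := by
  rw [shSumU, List.sum_map_filter_eq, ← sum_map_shSplits_unsigned]
  simp only [beq_iff_eq]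

lemma splitSum_ite (c : Prop) [Decidable c] (ε : ℤ) (l : List α) (F : List α → List α → V) :
    (if c then splitSum ε l F else 0) = splitSum ε l fun p q => if c then F p q else 0 := by
  split_ifs with h
  · rfl
  · rw [splitSum_zero]

end Shuffles

section Bridge

variable {𝕜 : Type u} [Field 𝕜] {L : Type v} [AddCommGroup L] [Module 𝕜 L]
variable {A : LeibnizAlg 𝕜 L} {S : Type w} [CommRing S] [Algebra 𝕜 S]
variable {ι : A.leftCenter →ₗ[𝕜] S} {n m : ℕ}
variable {ω η : ℕ → List L → List A.leftCenter → S}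
variable {ωt ηt : ℕ → List L → List A.leftCenter → S ⊗[𝕜] L}
variable {ωc ηc : ℕ → List L → S → List A.leftCenter → S}

/-- The values of an `n`-cochain, extended by zero to words of the wrong degree. -/
def truncVal (n : ℕ) (ω : ℕ → List L → List A.leftCenter → S) (a : A.Word) : S :=
  if 2 * a.2.length + a.1.length = n then ω a.2.length a.1 a.2 else 0

/-- The preimages of an `n`-cochain, extended by zero to words of the wrong degree. -/
def truncPre (n : ℕ) (ωt : ℕ → List L → List A.leftCenter → S ⊗[𝕜] L) (a : A.Word) : S ⊗[𝕜] L :=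
  if 2 * a.2.length + (a.1.length + 1) = n then ωt a.2.length a.1 a.2 else 0

/-- The derivations extending an `n`-cochain, extended by zero to words of the wrong degree. -/
def truncDer (h : IsExt A S ι n ω ωc) (a : A.Word) : Derivation 𝕜 S S :=
  if ha : 2 * (a.2.length + 1) + a.1.length = n then
    Derivation.mk'
      { toFun := fun x => ωc a.2.length a.1 x a.2
        map_add' := fun x y => h.map_add _ _ _ x y ha rfl
        map_smul' := fun c x => h.map_smul _ _ _ c x ha rfl }
      fun x y => h.mul_rule _ _ _ x y ha rfl
  else 0

lemma truncDer_apply (h : IsExt A S ι n ω ωc) (a : A.Word) (x : S) :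
    truncDer h a x =
      if 2 * (a.2.length + 1) + a.1.length = n then ωc a.2.length a.1 x a.2 else 0 := by
  rw [truncDer]
  split_ifs <;> rfl

/-- The bracket data of an `n`-cochain, with degree replaced by `d` of the same parity. -/
def BracketData.ofCochain (hT : IsPre A S ι n ω ωt) (hC : IsExt A S ι n ω ωc) (d : ℕ)
    (hd : Even n ↔ Even d) : BracketData A S ι where
  deg := d
  val := truncVal n ω
  pre := truncPre n ωt
  der := truncDer hC
  pairT_pre a e := by
    rw [truncPre, truncVal]
    simp only [List.length_append, List.length_singleton]
    split_ifs with h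
    · exact hT _ _ _ h rfl e
    · simp
  der_ι a f := by
    rw [truncDer_apply, truncVal]
    simp only [List.length_cons]
    split_ifs with h
    · exact hC.on_gen _ _ _ f h rfl
    · rfl
  val_eq_zero a h := by
    rw [truncVal, if_neg]
    rintro rfl
    simp only [Nat.even_add, Nat.even_mul, even_two, true_or, true_iff] at h hd
    tauto
  pre_eq_zero a h := by
    rw [truncPre, if_neg]
    rintro rfl
    simp only [Nat.even_add, Nat.even_mul, even_two, true_or, true_iff, Nat.not_even_one,
      iff_false] at h hd
    tauto
  der_eq_zero a h := by
    rw [truncDer, dif_neg]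
    rintro rfl
    simp only [Nat.even_add, Nat.even_mul, even_two, true_or, true_iff] at h hd
    tauto

lemma BracketData.isWeaklySkew_ofCochain (hω : IsCochain A S n ω) (hT : IsPre A S ι n ω ωt)
    (hC : IsExt A S ι n ω ωc) (d : ℕ) (hd : Even n ↔ Even d) :
    (ofCochain hT hC d hd).IsWeaklySkew where
  skew a e e' := by
    simp only [ofCochain, truncVal, List.length_append, List.length_cons, List.length_nil]
    have h : 2 * (a.2.length + 1) + a.1.length = n ↔
        2 * a.2.length + (a.1.length + (0 + 1 + 1)) = n := by omega
    simp only [h]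
    split_ifs with h'
    · have := hω.skew a.2.length a.1 [] e e' a.2 (by simpa using h') rfl
      simpa using this
    · simp
  symm a f f' := by
    simp only [ofCochain, truncVal, List.length_cons]
    split_ifs with h
    · exact hω.symm_f _ a.1 [] a.2 f f' h (by simp; omega)
    · rfl

/-- The zero bracket data. -/
def BracketData.zero (A : LeibnizAlg 𝕜 L) (S : Type w) [CommRing S] [Algebra 𝕜 S]
    (ι : A.leftCenter →ₗ[𝕜] S) (d : ℕ) : BracketData A S ι where
  deg := d
  val _ := 0
  pre _ := 0
  der _ := 0
  pairT_pre a e := by simp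
  der_ι a f := rfl
  val_eq_zero _ _ := rfl
  pre_eq_zero _ _ := rfl
  der_eq_zero _ _ := rfl

lemma cbull_eq {k : ℕ} {es : List L} {fs : List A.leftCenter}
    (h : 2 * k + es.length + 2 = n + m) (hk : fs.length = k) :
    cbull A S ι n m ωt ηt k es fs = wordSum (es, fs) fun a b =>
      -((-1 : ℤ) ^ m • pairT A S ι (truncPre n ωt a) (truncPre m ηt b)) := by
  simp only [cbull, shSum_eq, shSumU_eq, splitSum_ite, ← splitSum_sum, smul_splitSum, wordSum]
  refine splitSum_congr _ _ fun p q hpq => splitSum_congr _ _ fun r s hrs => ?_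
  rw [Finset.sum_eq_single r.length fun i _ hi => by simp [hi.symm]]
  · have hs : k - r.length = s.length := by omega
    by_cases h' : 2 * r.length + (p.length + 1) = n
    · have hm : 2 * s.length + (q.length + 1) = m := by omega
      have hm' : (-1 : ℤ) ^ m = -(-1) ^ (m - 1) := by
        rw [← Nat.sub_add_cancel (show 1 ≤ m by omega), pow_succ]
        simp
      rw [truncPre, truncPre, if_pos h', if_pos hm, hs, if_pos ⟨by omega, by omega⟩,
        if_pos (show p.length = n - 2 * r.length - 1 by omega), if_pos rfl, hm', neg_smul, neg_neg]
    · rw [truncPre, if_neg h', map_zero, LinearMap.zero_apply, smul_zero, neg_zero]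
      split_ifs <;> first | omega | simp
  · intro hr
    simp only [Finset.mem_range] at hr
    omega

lemma cdiam_eq (hC : IsExt A S ι n ω ωc) {k : ℕ} {es : List L} {fs : List A.leftCenter}
    (h : 2 * k + es.length + 2 = n + m) (hk : fs.length = k) :
    cdiam A S n m ωc η k es fs = wordSum (es, fs) fun a b => truncDer hC a (truncVal m η b) := by
  simp only [cdiam, shSum_eq, shSumU_eq, splitSum_ite, ← splitSum_sum, wordSum]
  refine splitSum_congr _ _ fun p q hpq => ?_
  rw [splitSum_swap (by norm_num)]
  refine splitSum_congr _ _ fun r s hrs => ?_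
  simp only [one_pow, one_smul]
  rw [Finset.sum_eq_single r.length]
  · have hs : k - r.length = s.length := by omega
    rw [truncDer_apply]
    change _ = if 2 * (r.length + 1) + p.length = n then ωc r.length p _ r else 0
    by_cases h' : 2 * (r.length + 1) + p.length = n
    · have hm : 2 * s.length + q.length = m := by omega
      rw [truncVal, if_pos h', if_pos hm, hs, if_pos ⟨by omega, by omega⟩,
        if_pos (show p.length = n - 2 * r.length - 2 by omega), if_pos rfl]
    · rw [if_neg h']
      split_ifs <;> first | omega | rfl
  · intro i hi his
    simp only [Finset.mem_range] at hi
    split_ifs <;> first | omega | rfl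
  · intro hr
    simp only [Finset.mem_range] at hr
    omega

lemma cpbr_eq (hT : IsPre A S ι n ω ωt) (hC : IsExt A S ι n ω ωc) (hT' : IsPre A S ι m η ηt)
    (hC' : IsExt A S ι m η ηc) {d d' : ℕ} (hd : Even n ↔ Even d) (hd' : Even m ↔ Even d')
    {k : ℕ} {es : List L} {fs : List A.leftCenter} (h : 2 * k + es.length + 2 = n + m)
    (hk : fs.length = k) :
    cpbr A S ι n m ω η ωt ηt ωc ηc k es fs =
      (BracketData.ofCochain hT hC d hd).bracket (BracketData.ofCochain hT' hC' d' hd')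
        (es, fs) := by
  rw [cpbr, cbull_eq h hk, cdiam_eq hC h hk, cdiam_eq hC' (by omega) hk, wordSum_swap _
    fun a b => truncDer hC' a (truncVal n ω b), sub_eq_add_neg, ← neg_smul, smul_wordSum,
    ← wordSum_add, ← wordSum_add]
  refine wordSum_congr _ fun a b ha hb => ?_
  rw [BracketData.summand]
  simp only [BracketData.ofCochain, neg_one_pow_congr hd', sub_eq_add_neg, smul_smul]
  congr 1
  rw [truncDer_apply, truncVal]
  split_ifs with h₁ h₂
  · have hs : (-1 : ℤ) ^ (b.1.length * a.1.length) = (-1) ^ (n * m) := neg_one_pow_congr (by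
      rw [← h₁, ← h₂]
      simp only [Nat.even_add, Nat.even_mul, even_two, true_or, true_iff]
      tauto)
    rw [mul_comm a.1.length, hs, neg_mul, ← pow_add, Even.neg_one_pow ⟨_, rfl⟩, neg_smul, one_smul]
  · simp only at ha hb
    omega
  · rw [smul_zero, neg_zero]

lemma BracketData.bracket_ofCochain_eq_zero (hT : IsPre A S ι n ω ωt) (hC : IsExt A S ι n ω ωc)
    (hT' : IsPre A S ι m η ηt) (hC' : IsExt A S ι m η ηc) {d d' : ℕ} (hd : Even n ↔ Even d)
    (hd' : Even m ↔ Even d') {u : A.Word} (h : 2 * u.2.length + u.1.length + 2 ≠ n + m) :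
    (ofCochain hT hC d hd).bracket (ofCochain hT' hC' d' hd') u = 0 := by
  rw [bracket, ← wordSum_zero u]
  refine wordSum_congr _ fun a b ha hb => ?_
  have h₁ : truncPre n ωt a = 0 ∨ truncPre m ηt b = 0 := by
    by_cases h' : 2 * a.2.length + (a.1.length + 1) = n
    · exact .inr (if_neg (by omega))
    · exact .inl (if_neg h')
  have h₂ : truncDer hC a = 0 ∨ truncVal m η b = 0 := by
    by_cases h' : 2 * (a.2.length + 1) + a.1.length = n
    · exact .inr (if_neg (by omega))
    · exact .inl (by ext; rw [truncDer_apply]; exact if_neg h')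
  have h₃ : truncDer hC' b = 0 ∨ truncVal n ω a = 0 := by
    by_cases h' : 2 * (b.2.length + 1) + b.1.length = m
    · exact .inr (if_neg (by omega))
    · exact .inl (by ext; rw [truncDer_apply]; exact if_neg h')
  simp only [summand, ofCochain]
  rcases h₁ with h₁ | h₁ <;> rcases h₂ with h₂ | h₂ <;> rcases h₃ with h₃ | h₃ <;>
    simp [h₁, h₂, h₃]

lemma BracketData.bracket_zero (X : BracketData A S ι) (d : ℕ) (u : A.Word) :
    X.bracket (zero A S ι d) u = 0 := by
  rw [bracket, ← wordSum_zero u]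
  exact wordSum_congr _ fun a b _ _ => by simp [summand, zero]

lemma BracketData.zero_bracket (X : BracketData A S ι) (d : ℕ) (u : A.Word) :
    (zero A S ι d).bracket X u = 0 := by
  rw [bracket_comm, bracket_zero, smul_zero, neg_zero]

omit [Algebra 𝕜 S] in
lemma cdiam_zero_left {k : ℕ} {es : List L} {fs : List A.leftCenter} :
    cdiam A S 0 m ωc η k es fs = 0 :=
  Finset.sum_eq_zero fun i _ => if_neg (by omega)

omit [Algebra 𝕜 S] in
lemma cdiam_zero_right {k : ℕ} {es : List L} {fs : List A.leftCenter}
    (h : 2 * k + es.length + 2 < n) : cdiam A S n 0 ωc η k es fs = 0 := by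
  refine Finset.sum_eq_zero fun i hi => ?_
  rw [shSum_eq, ite_eq_right_iff]
  refine fun _ => (splitSum_congr _ _ fun p q hpq => if_neg ?_).trans (splitSum_zero (-1 : ℤ) es)
  rw [Finset.mem_range] at hi
  omega

lemma cbull_zero_left {k : ℕ} {es : List L} {fs : List A.leftCenter} :
    cbull A S ι 0 m ωt ηt k es fs = 0 := by
  rw [cbull, Finset.sum_eq_zero fun i _ => if_neg (by omega), smul_zero]

lemma cbull_zero_right {k : ℕ} {es : List L} {fs : List A.leftCenter} :
    cbull A S ι n 0 ωt ηt k es fs = 0 := by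
  rw [cbull, Finset.sum_eq_zero fun i _ => if_neg (by omega), smul_zero]

lemma cpbr_zero_left {k : ℕ} {es : List L} {fs : List A.leftCenter}
    (h : 2 * k + es.length + 2 < m) : cpbr A S ι 0 m ω η ωt ηt ωc ηc k es fs = 0 := by
  rw [cpbr, cbull_zero_left, cdiam_zero_left, cdiam_zero_right h, smul_zero, add_zero, sub_zero]

lemma cpbr_zero_right {k : ℕ} {es : List L} {fs : List A.leftCenter}
    (h : 2 * k + es.length + 2 < n) : cpbr A S ι n 0 ω η ωt ηt ωc ηc k es fs = 0 := by
  rw [cpbr, cbull_zero_right, cdiam_zero_left, cdiam_zero_right h, smul_zero, add_zero, sub_zero]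

/-- Bracket data of the bracket of two cochains. -/
lemma exists_bracketData_cpbr (hT : IsPre A S ι n ω ωt) (hC : IsExt A S ι n ω ωc)
    (hT' : IsPre A S ι m η ηt) (hC' : IsExt A S ι m η ηc)
    {bT : ℕ → List L → List A.leftCenter → S ⊗[𝕜] L}
    {bC : ℕ → List L → S → List A.leftCenter → S}
    (hbT : IsPre A S ι (n + m - 2) (cpbr A S ι n m ω η ωt ηt ωc ηc) bT)
    (hbC : IsExt A S ι (n + m - 2) (cpbr A S ι n m ω η ωt ηt ωc ηc) bC)
    {l : ℕ} {lam : ℕ → List L → List A.leftCenter → S}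
    {lamt : ℕ → List L → List A.leftCenter → S ⊗[𝕜] L}
    {lamc : ℕ → List L → S → List A.leftCenter → S}
    (hT'' : IsPre A S ι l lam lamt) (hC'' : IsExt A S ι l lam lamc) :
    ∃ β : BracketData A S ι, β.deg = n + m ∧
      (∀ u, β.val u = (BracketData.ofCochain hT hC n Iff.rfl).bracket
        (BracketData.ofCochain hT' hC' m Iff.rfl) u) ∧
      ∀ (k : ℕ) (es : List L) (fs : List A.leftCenter),
        2 * k + es.length + 4 = n + m + l → fs.length = k →
        cpbr A S ι (n + m - 2) l (cpbr A S ι n m ω η ωt ηt ωc ηc) lam bT lamt bC lamc k es fs =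
          β.bracket (BracketData.ofCochain hT'' hC'' l Iff.rfl) (es, fs) ∧
        cpbr A S ι l (n + m - 2) lam (cpbr A S ι n m ω η ωt ηt ωc ηc) lamt bT lamc bC k es fs =
          (BracketData.ofCochain hT'' hC'' l Iff.rfl).bracket β (es, fs) := by
  by_cases h : 2 ≤ n + m
  · have hd : Even (n + m - 2) ↔ Even (n + m) := by simp [Nat.even_sub h]
    refine ⟨BracketData.ofCochain hbT hbC (n + m) hd, rfl, fun u => ?_, fun k es fs hk hfs =>
      ⟨cpbr_eq hbT hbC hT'' hC'' hd Iff.rfl (by omega) hfs,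
        cpbr_eq hT'' hC'' hbT hbC Iff.rfl hd (by omega) hfs⟩⟩
    by_cases hu : 2 * u.2.length + u.1.length + 2 = n + m
    · rw [← cpbr_eq hT hC hT' hC' Iff.rfl Iff.rfl hu rfl]
      exact if_pos (by omega)
    · rw [BracketData.bracket_ofCochain_eq_zero hT hC hT' hC' Iff.rfl Iff.rfl hu]
      exact if_neg (by omega)
  · refine ⟨BracketData.zero A S ι (n + m), rfl, fun u => ?_, fun k es fs hk hfs => ?_⟩
    · rw [BracketData.bracket_ofCochain_eq_zero hT hC hT' hC' Iff.rfl Iff.rfl (by omega)]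
      rfl
    · rw [BracketData.zero_bracket, BracketData.bracket_zero]
      clear hbT hbC
      generalize cpbr A S ι n m ω η ωt ηt ωc ηc = β
      rw [show n + m - 2 = 0 by omega]
      exact ⟨cpbr_zero_left (by omega), cpbr_zero_right (by omega)⟩

end Bridge

section Theorems

variable {𝕜 : Type u} [Field 𝕜] {L : Type v} [AddCommGroup L] [Module 𝕜 L]

theorem cpbr_jacobi (A : LeibnizAlg 𝕜 L) (S : Type w) [CommRing S] [Algebra 𝕜 S]
    (ι : A.leftCenter →ₗ[𝕜] S) (hS : IsSymAlg S ι)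
    (n m l : ℕ) (ω η lam : ℕ → List L → List A.leftCenter → S)
    (hω : IsCochain A S n ω) (hη : IsCochain A S m η) (hlam : IsCochain A S l lam)
    (ωt ηt lamt : ℕ → List L → List A.leftCenter → S ⊗[𝕜] L)
    (hωt : IsPre A S ι n ω ωt) (hηt : IsPre A S ι m η ηt)
    (hlamt : IsPre A S ι l lam lamt)
    (ωc ηc lamc : ℕ → List L → S → List A.leftCenter → S)
    (hωc : IsExt A S ι n ω ωc) (hηc : IsExt A S ι m η ηc)
    (hlamc : IsExt A S ι l lam lamc)
    (bEtaLamT bOmEtaT bOmLamT : ℕ → List L → List A.leftCenter → S ⊗[𝕜] L)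
    (hbEtaLamT : IsPre A S ι (m+l-2) (cpbr A S ι m l η lam ηt lamt ηc lamc) bEtaLamT)
    (hbOmEtaT : IsPre A S ι (n+m-2) (cpbr A S ι n m ω η ωt ηt ωc ηc) bOmEtaT)
    (hbOmLamT : IsPre A S ι (n+l-2) (cpbr A S ι n l ω lam ωt lamt ωc lamc) bOmLamT)
    (bEtaLamC bOmEtaC bOmLamC : ℕ → List L → S → List A.leftCenter → S)
    (hbEtaLamC : IsExt A S ι (m+l-2) (cpbr A S ι m l η lam ηt lamt ηc lamc) bEtaLamC)
    (hbOmEtaC : IsExt A S ι (n+m-2) (cpbr A S ι n m ω η ωt ηt ωc ηc) bOmEtaC)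
    (hbOmLamC : IsExt A S ι (n+l-2) (cpbr A S ι n l ω lam ωt lamt ωc lamc) bOmLamC) :
    ∀ (k : ℕ) (es : List L) (fs : List A.leftCenter),
      2*k + es.length + 4 = n + m + l → fs.length = k →
      cpbr A S ι n (m+l-2) ω (cpbr A S ι m l η lam ηt lamt ηc lamc) ωt bEtaLamT ωc bEtaLamC k es fs
        = cpbr A S ι (n+m-2) l (cpbr A S ι n m ω η ωt ηt ωc ηc) lam bOmEtaT lamt bOmEtaC lamc k es fs
          + (-1 : ℤ)^(n*m) •
              cpbr A S ι m (n+l-2) η (cpbr A S ι n l ω lam ωt lamt ωc lamc) ηt bOmLamT ηc bOmLamC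
                k es fs := by
  intro k es fs hk hfs
  obtain ⟨βYZ, dYZ, vYZ, hYZ⟩ :=
    exists_bracketData_cpbr hηt hηc hlamt hlamc hbEtaLamT hbEtaLamC hωt hωc
  obtain ⟨βXY, dXY, vXY, hXY⟩ :=
    exists_bracketData_cpbr hωt hωc hηt hηc hbOmEtaT hbOmEtaC hlamt hlamc
  obtain ⟨βXZ, dXZ, vXZ, hXZ⟩ :=
    exists_bracketData_cpbr hωt hωc hlamt hlamc hbOmLamT hbOmLamC hηt hηc
  rw [(hYZ k es fs (by omega) hfs).2, (hXY k es fs (by omega) hfs).1,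
    (hXZ k es fs (by omega) hfs).2]
  exact BracketData.bracket_jacobi hS (BracketData.isWeaklySkew_ofCochain hω hωt hωc n Iff.rfl)
    (BracketData.isWeaklySkew_ofCochain hη hηt hηc m Iff.rfl)
    (BracketData.isWeaklySkew_ofCochain hlam hlamt hlamc l Iff.rfl) vYZ vXY vXZ dYZ dXY dXZ _

end Theorems
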